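/- Let -d < 0 be a fundamental discriminant with d > 4, let g be the number of distinct prime divisors of d, and suppose the class group of Q(√-d) has one class per genus. If additionally L(1,χ_d) ≥ 1/(log d)^74, then d ≤ d₂₃₀, the product of the first 230 primes. -/

import Mathlib

open Real Finset

/-- `D` is a fundamental discriminant: either `D ≡ 1 (mod 4)` and `D` is squarefree, or
`D = 4m` with `m` squarefree and `m ≡ 2` or `3 (mod 4)`. -/
def IsFundamentalDiscriminant (D : ℤ) : Prop :=
  (D % 4 = 1 ∧ Squarefree D) ∨
    (D % 4 = 0 ∧ Squarefree (D / 4) ∧ ((D / 4) % 4 = 2 ∨ (D / 4) % 4 = 3))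

/-- `χ` is the quadratic Dirichlet character of conductor `d` attached to `ℚ(√-d)`:
it agrees with the Legendre symbol `((-d)/p)` at all odd primes `p ∤ d`. -/
def IsQuadFieldChar (d : ℕ) [NeZero d] (χ : DirichletCharacter ℂ d) : Prop :=
  ∀ p : ℕ, (hp : p.Prime) → p ≠ 2 → ¬ p ∣ d →
    χ p = (@legendreSym p ⟨hp⟩ (-(d : ℤ)) : ℂ)


section


lemma oc_prod_nth_count (n : ℕ) : ∏ i ∈ range (Nat.count Nat.Prime n), Nat.nth Nat.Prime i
    = ∏ p ∈ (range n).filter Nat.Prime, p := by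
  induction n with
  | zero => simp
  | succ n ih =>
    rw [Nat.count_succ, range_add_one, filter_insert]
    split_ifs with h
    · rw [prod_range_succ, prod_insert (by simp), ih, Nat.nth_count h, mul_comm]
    · simpa using ih

def ocTest (q : ℕ) : Bool := decide (2 ≤ q) && (List.range 39).all (fun r => r < 2 || r == q || q % r != 0)

lemma oc_prime_iff (q : ℕ) (hq : q < 1452) : Nat.Prime q ↔ ocTest q = true := by
  simp only [ocTest, Bool.and_eq_true, decide_eq_true_eq, List.all_eq_true, List.mem_range,
    Bool.or_eq_true, beq_iff_eq, bne_iff_ne, ne_eq]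
  constructor
  · intro h
    refine ⟨h.two_le, fun r hr => ?_⟩
    by_cases h2 : r < 2
    · simp [h2]
    by_cases h3 : r = q
    · simp [h3]
    · right
      intro h4
      have := (Nat.dvd_prime h).1 (Nat.dvd_of_mod_eq_zero h4)
      omega
  · rintro ⟨h2, h⟩
    by_contra hp
    have h1 := Nat.minFac_sq_le_self (by omega) hp
    have h3 : q.minFac < 39 := by nlinarith
    have h4 := (Nat.minFac_prime (show q ≠ 1 by omega)).two_le
    rcases h _ h3 with (h5 | h5) | h5
    · omega
    · exact hp (h5 ▸ Nat.minFac_prime (show q ≠ 1 by omega))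
    · exact h5 (Nat.mod_eq_zero_of_dvd (Nat.minFac_dvd q))

lemma oc_filter : (range 1452).filter Nat.Prime = (range 1452).filter (fun q => ocTest q = true) :=
  filter_congr (fun q hq => oc_prime_iff q (mem_range.1 hq))

lemma oc_count : Nat.count Nat.Prime 1452 = 230 := by
  rw [Nat.count_eq_card_filter_range, oc_filter]
  decide +kernel

lemma oc_N_ge : 2 ^ 4029 ≤ (∏ i ∈ range 230, Nat.nth Nat.Prime i) ^ 2 := by
  rw [← oc_count, oc_prod_nth_count, oc_filter]
  decide +kernel

lemma oc_prod_primes_ge (n : ℕ) : ∀ S : Finset ℕ, (∀ p ∈ S, p.Prime) → S.card = n →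
    ∏ i ∈ range n, Nat.nth Nat.Prime i ≤ ∏ p ∈ S, p := by
  induction n with
  | zero => intro S _ h; simp [card_eq_zero.1 h]
  | succ n ih =>
    intro S hS hc
    have hne : S.Nonempty := card_pos.1 (by omega)
    set m := S.max' hne with hm
    have hmS : m ∈ S := S.max'_mem hne
    rw [prod_range_succ, ← prod_erase_mul S _ hmS]
    apply Nat.mul_le_mul
    · apply ih
      · intro p hp; exact hS p (mem_of_mem_erase hp)
      · rw [card_erase_of_mem hmS]; omega
    · have h1 : n ≤ Nat.count Nat.Prime m := by
        rw [Nat.count_eq_card_filter_range]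
        have hsub : S.erase m ⊆ (range m).filter Nat.Prime := by
          intro p hp
          rw [mem_filter, mem_range]
          exact ⟨lt_of_le_of_ne (S.le_max' p (mem_of_mem_erase hp)) (ne_of_mem_erase hp), hS p (mem_of_mem_erase hp)⟩
        have := card_le_card hsub
        rw [card_erase_of_mem hmS, hc] at this; simpa using this
      calc Nat.nth Nat.Prime n ≤ Nat.nth Nat.Prime (Nat.count Nat.Prime m) :=
            Nat.nth_monotone Nat.infinite_setOfPred_prime h1
        _ = m := Nat.nth_count (hS m hmS)

lemma oc_prod_split (M k : ℕ) (hM : 6 ≤ M) : (∏ i ∈ range M, Nat.nth Nat.Prime i) * 8 ^ k ≤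
    ∏ i ∈ range (M + k), Nat.nth Nat.Prime i := by
  induction k with
  | zero => simp
  | succ k ih =>
    rw [← add_assoc, prod_range_succ, pow_succ, ← mul_assoc]
    apply Nat.mul_le_mul ih
    have := Nat.add_two_le_nth_prime (M + k)
    omega

lemma oc_numeric_core (N d g k : ℕ) (hNpos : 0 < N) (hN2 : 2 ^ 4029 ≤ N ^ 2) (hd0 : 0 < d)
    (hk1 : g ≤ 230 + k) (hk2 : N * 8 ^ k ≤ d) :
    (2:ℝ) ^ (g - 1) * (3 * π) * (Real.log d) ^ 74 < √d := by
  have l2a := Real.log_two_gt_d9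
  have l2b := Real.log_two_lt_d9
  set l := Real.log 2 with hl
  have hlN : (4029:ℝ) * l ≤ 2 * Real.log N := by
    have h := hN2
    have h' : (2:ℝ) ^ 4029 ≤ (N:ℝ) ^ 2 := by exact_mod_cast h
    have := Real.log_le_log (by positivity) h'
    rw [Real.log_pow, Real.log_pow] at this
    exact_mod_cast this
  have hld : Real.log N + k * (3 * l) ≤ Real.log d := by
    have h' : (N:ℝ) * 8 ^ k ≤ d := by exact_mod_cast hk2
    have := Real.log_le_log (by positivity) h'
    rw [Real.log_mul (by positivity) (by positivity), Real.log_pow, show (8:ℝ) = 2 ^ 3 by norm_num, Real.log_pow] at this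
    exact_mod_cast this
  have h1396 : 20 * Real.log 1396 ≤ 209 * l := by
    have := Real.log_le_log (by norm_num) (show (1396:ℝ) ^ 20 ≤ 2 ^ 209 by norm_num)
    rw [Real.log_pow, Real.log_pow] at this
    exact_mod_cast this
  have hpi : 4 * Real.log (3 * π) ≤ 13 * l := by
    have h0 : (3 * π) ^ 4 ≤ 2 ^ 13 := by
      have : 3 * π ≤ 9.45 := by linarith [Real.pi_lt_d2]
      calc (3 * π) ^ 4 ≤ 9.45 ^ 4 := by gcongr
        _ ≤ _ := by norm_num
    have := Real.log_le_log (by positivity) h0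
    rw [Real.log_pow, Real.log_pow] at this
    exact_mod_cast this
  set x := Real.log d with hx
  have hk0 : (0:ℝ) ≤ k := by positivity
  have hxpos : 0 < x := by nlinarith
  have htan : Real.log x ≤ Real.log 1396 + x / 1396 - 1 := by
    have := Real.log_le_sub_one_of_pos (show 0 < x / 1396 by positivity)
    rw [Real.log_div (by positivity) (by norm_num)] at this
    linarith
  have hd' : (0:ℝ) < d := by exact_mod_cast hd0
  rw [← Real.log_lt_log_iff (by positivity) (by positivity), Real.log_sqrt (by positivity),
    Real.log_mul (by positivity) (by positivity), Real.log_mul (by positivity) (by positivity),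
    Real.log_pow, Real.log_pow, ← hx, ← hl]
  have hg' : ((g - 1 : ℕ) : ℝ) ≤ 229 + k := by
    have : g - 1 ≤ 229 + k := by omega
    exact_mod_cast this
  have hgl : ((g - 1 : ℕ) : ℝ) * l ≤ (229 + k) * l := by gcongr
  have hkl : 0 ≤ (k:ℝ) * l := by positivity
  push_cast
  nlinarith

lemma oc_numeric (d : ℕ) (hd : ∏ i ∈ range 230, Nat.nth Nat.Prime i < d) :
    (2:ℝ) ^ (d.primeFactors.card - 1) * (3 * π) * (Real.log d) ^ 74 < √d := by
  have hd0 : 0 < d := by omega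
  have h2 := oc_N_ge
  have hs := fun k => oc_prod_split 230 k (by norm_num)
  have hpp := oc_prod_primes_ge
  generalize hg : d.primeFactors.card = g
  generalize hM : (230 : ℕ) = M at *
  generalize hN : ∏ i ∈ range M, Nat.nth Nat.Prime i = N at *
  have hNpos : 0 < N := by
    rcases Nat.eq_zero_or_pos N with h | h
    · rw [h] at h2
      exact absurd h2 (by simp)
    · exact h
  obtain ⟨k, hk1, hk2⟩ : ∃ k, g ≤ M + k ∧ N * 8 ^ k ≤ d := by
    rcases le_or_gt g M with h | h
    · exact ⟨0, by omega, by simpa using hd.le⟩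
    · refine ⟨g - M, by omega, (hs _).trans ?_⟩
      rw [show M + (g - M) = g by omega]
      exact (hpp g d.primeFactors (fun p hp => Nat.prime_of_mem_primeFactors hp) hg).trans
        (Nat.le_of_dvd hd0 (Nat.prod_primeFactors_dvd d))
  exact oc_numeric_core N d g k hNpos h2 hd0 (by omega) hk2

lemma oc_euler {R : Type*} [CommRing R] [IsDedekindDomain R] (F : Ideal R → ℝ)
    (hmul : ∀ I J, F (I * J) = F I * F J) (hnn : ∀ I, 0 ≤ F I) (hs : Summable F)
    (T : Finset (Ideal R)) (hT : ∀ P ∈ T, Prime P) :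
    (∏ P ∈ T, (1 - F P)) * ∑' I, F I = ∑' I, Set.indicator {I | ∀ Q ∈ T, ¬ Q ∣ I} F I := by
  classical
  induction T using Finset.induction_on with
  | empty => simp
  | insert P T hPT ih =>
    have hP : Prime P := hT P (by simp)
    have hT' : ∀ Q ∈ T, Prime Q := fun Q hQ => hT Q (by simp [hQ])
    rw [prod_insert hPT, mul_assoc, ih hT']
    set A : Set (Ideal R) := {I | ∀ Q ∈ T, ¬ Q ∣ I} with hA
    set B : Set (Ideal R) := {I | ∀ Q ∈ insert P T, ¬ Q ∣ I} with hB
    have h1 : Summable (A.indicator F) := hs.indicator A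
    have h2 : Summable (B.indicator F) := hs.indicator B
    have h3 : ∑' J, F P * A.indicator F J = ∑' I, (A.indicator F I - B.indicator F I) := by
      have hinj : Function.Injective (fun J : Ideal R => P * J) := mul_right_injective₀ hP.ne_zero
      rw [← hinj.tsum_eq (f := fun I => A.indicator F I - B.indicator F I)]
      · apply tsum_congr
        intro J
        have hb : P * J ∉ B := fun h => h P (by simp) (dvd_mul_right _ _)
        have ha : P * J ∈ A ↔ J ∈ A := by
          simp only [hA, Set.mem_ofPred_eq]
          refine forall₂_congr fun Q hQ => not_congr ⟨fun h => ?_, fun h => h.mul_left _⟩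
          rcases (hT' Q hQ).dvd_or_dvd h with h | h
          · have := ((hT' Q hQ).dvd_prime_iff_associated hP).1 h
            rw [associated_iff_eq] at this
            exact absurd (this ▸ hQ) hPT
          · exact h
        show F P * A.indicator F J = A.indicator F (P * J) - B.indicator F (P * J)
        rw [Set.indicator_of_notMem hb]
        by_cases hJ : J ∈ A
        · rw [Set.indicator_of_mem hJ, Set.indicator_of_mem (ha.2 hJ), hmul, sub_zero]
        · rw [Set.indicator_of_notMem hJ, Set.indicator_of_notMem (mt ha.1 hJ)]; simp
      · intro I hI
        by_contra hr
        apply hI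
        show A.indicator F I - B.indicator F I = 0
        have hPI : ¬ P ∣ I := by
          rintro ⟨J, rfl⟩
          exact hr ⟨J, rfl⟩
        have : I ∈ A ↔ I ∈ B := by
          simp [hA, hB, hPI]
        by_cases hI : I ∈ A
        · rw [Set.indicator_of_mem hI, Set.indicator_of_mem (this.1 hI), sub_self]
        · rw [Set.indicator_of_notMem hI, Set.indicator_of_notMem (mt this.2 hI), sub_self]
    rw [tsum_mul_left, h1.tsum_sub h2] at h3
    linarith

lemma oc_euler_le {R : Type*} [CommRing R] [IsDedekindDomain R] (F : Ideal R → ℝ)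
    (hmul : ∀ I J, F (I * J) = F I * F J) (hnn : ∀ I, 0 ≤ F I) (hs : Summable F) (h1 : F 1 = 1)
    (T : Finset (Ideal R)) (hT : ∀ P ∈ T, Prime P) (hlt : ∀ P ∈ T, F P < 1) :
    (∏ P ∈ T, (1 - F P)⁻¹) ≤ ∑' I, F I := by
  have h := oc_euler F hmul hnn hs T hT
  have hpos : 0 < ∏ P ∈ T, (1 - F P) := prod_pos fun P hP => by linarith [hlt P hP]
  rw [prod_inv_distrib, inv_le_iff_one_le_mul₀ hpos, mul_comm, h]
  have h0 := (hs.indicator {I | ∀ Q ∈ T, ¬ Q ∣ I}).le_tsum 1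
    (fun J _ => Set.indicator_nonneg (fun _ _ => hnn _) _)
  rwa [Set.indicator_of_mem, h1] at h0
  intro Q hQ hd
  exact (hT Q hQ).not_isUnit (isUnit_of_dvd_one hd)

open NumberField Filter Topology

lemma oc_zeta_hasSum (K : Type) [Field K] [NumberField K] (s : ℝ) (hs : 1 < s)
    (hne : dedekindZeta K s ≠ 0) :
    Summable (fun I : Ideal (𝓞 K) => (Ideal.absNorm I : ℝ) ^ (-s)) ∧
    dedekindZeta K s = ((∑' I : Ideal (𝓞 K), (Ideal.absNorm I : ℝ) ^ (-s) : ℝ) : ℂ) := by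
  set a : ℕ → ℝ := fun n => (Nat.card {I : Ideal (𝓞 K) // Ideal.absNorm I = n} : ℝ) * (n:ℝ) ^ (-s) with ha
  have hterm : ∀ n, LSeries.term (fun n ↦ (Nat.card {I : Ideal (𝓞 K) // Ideal.absNorm I = n} : ℂ)) s n = (a n : ℂ) := by
    intro n
    rw [LSeries.term_def]
    split_ifs with h
    · subst h
      have : (0:ℝ) ^ (-s) = 0 := Real.zero_rpow (by linarith)
      simp [ha, this]
    · rw [ha]
      push_cast
      rw [Complex.ofReal_cpow (by positivity), div_eq_mul_inv]
      push_cast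
      rw [Complex.cpow_neg]
  have hsum : Summable a := by
    by_contra hc
    apply hne
    rw [dedekindZeta, LSeries, tsum_eq_zero_of_not_summable]
    intro h
    apply hc
    rw [← Complex.summable_ofReal]
    exact h.congr hterm
  have hz : dedekindZeta K s = ((∑' n, a n : ℝ) : ℂ) := by
    rw [dedekindZeta, LSeries, Complex.ofReal_tsum]
    exact tsum_congr hterm
  let F : Ideal (𝓞 K) → ℝ := fun I => (Ideal.absNorm I : ℝ) ^ (-s)
  let e := Equiv.sigmaFiberEquiv (fun I : Ideal (𝓞 K) => Ideal.absNorm I)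
  have hfin : ∀ n : ℕ, Finite {I : Ideal (𝓞 K) // Ideal.absNorm I = n} := fun n =>
    (Ideal.finite_setOfPred_absNorm_eq n).to_subtype
  have hF : ∀ n, ∀ x : {I : Ideal (𝓞 K) // Ideal.absNorm I = n}, F (e ⟨n, x⟩) = (n:ℝ) ^ (-s) := by
    rintro n ⟨I, rfl⟩; rfl
  have hfib : ∀ n, ∑' x : {I : Ideal (𝓞 K) // Ideal.absNorm I = n}, F (e ⟨n, x⟩) = a n := by
    intro n
    have := hfin n
    have := Fintype.ofFinite {I : Ideal (𝓞 K) // Ideal.absNorm I = n}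
    rw [tsum_congr (hF n), tsum_fintype]
    simp [ha]
  have hS : Summable (fun x => F (e x)) := by
    rw [summable_sigma_of_nonneg (fun x => by positivity)]
    refine ⟨fun n => ?_, ?_⟩
    · have := hfin n
      exact Summable.of_finite
    · exact hsum.congr fun n => (hfib n).symm
  refine ⟨e.summable_iff.1 hS, ?_⟩
  rw [hz]
  congr 1
  rw [← e.tsum_eq, hS.tsum_sigma]
  exact tsum_congr fun n => (hfib n).symm
open NumberField

lemma oc_delta (K : Type) [Field K] [NumberField K] (hrank : Module.finrank ℚ K = 2) :
    ∃ δ : 𝓞 K, δ ^ 2 = ((discr K : ℤ) : 𝓞 K) ∧ Algebra.trace ℤ (𝓞 K) δ = 0 := by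
  classical
  have hfr : Module.finrank ℤ (𝓞 K) = 2 := by rw [RingOfIntegers.rank, hrank]
  let b : Module.Basis (Fin 2) ℤ (𝓞 K) := Module.finBasisOfFinrankEq ℤ (𝓞 K) hfr
  let T := Algebra.trace ℤ (𝓞 K)
  have hdisc : discr K = T (b 0 * b 0) * T (b 1 * b 1) - T (b 0 * b 1) * T (b 0 * b 1) := by
    rw [← NumberField.discr_eq_discr K b, Algebra.discr_def, Matrix.det_fin_two]
    simp [Algebra.traceMatrix_apply, Algebra.traceForm_apply, T, mul_comm (b 1) (b 0)]
  have hone : (1 : 𝓞 K) = b.repr 1 0 • b 0 + b.repr 1 1 • b 1 := by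
    have := b.sum_repr 1
    rw [Fin.sum_univ_two] at this
    exact this.symm
  generalize b.repr 1 0 = m at hone
  generalize b.repr 1 1 = n at hone
  have hT1 : T 1 = 2 := by
    have := Algebra.trace_algebraMap_of_basis b (1:ℤ)
    simpa [T] using this
  have e1 : 2 = m * T (b 0) + n * T (b 1) := by
    rw [← hT1, hone, map_add, map_smul, map_smul]; rfl
  have e2 : T (b 0) = m * T (b 0 * b 0) + n * T (b 0 * b 1) := by
    conv_lhs => rw [← mul_one (b 0), hone, mul_add, mul_smul_comm, mul_smul_comm, map_add, map_smul, map_smul]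
    rfl
  have e3 : T (b 1) = m * T (b 0 * b 1) + n * T (b 1 * b 1) := by
    conv_lhs => rw [← mul_one (b 1), hone, mul_add, mul_smul_comm, mul_smul_comm, map_add, map_smul, map_smul]
    rw [mul_comm (b 1) (b 0)]; rfl
  refine ⟨T (b 1) • b 0 - T (b 0) • b 1, ?_, ?_⟩
  swap
  · show T _ = 0
    rw [map_sub, map_smul, map_smul, smul_eq_mul, smul_eq_mul]; ring
  have htr : T (T (b 1) • b 0 - T (b 0) • b 1) = 0 := by
    rw [map_sub, map_smul, map_smul, smul_eq_mul, smul_eq_mul]; ring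
  have hsq : T ((T (b 1) • b 0 - T (b 0) • b 1) ^ 2) = 2 * discr K := by
    have : (T (b 1) • b 0 - T (b 0) • b 1) ^ 2 = (T (b 1) ^ 2) • (b 0 * b 0)
        - (2 * T (b 0) * T (b 1)) • (b 0 * b 1) + (T (b 0) ^ 2) • (b 1 * b 1) := by
      simp only [zsmul_eq_mul]; push_cast; ring
    rw [this, map_add, map_sub, map_smul, map_smul, map_smul, hdisc]
    simp only [smul_eq_mul]
    generalize T (b 0) = a at *
    generalize T (b 1) = c at *
    generalize T (b 0 * b 0) = A at *
    generalize T (b 1 * b 1) = B at *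
    generalize T (b 0 * b 1) = C at *
    subst e2 e3
    linear_combination (-(A * B - C * C)) * e1
  generalize T (b 1) • b 0 - T (b 0) • b 1 = δ at htr hsq ⊢
  let M := Algebra.leftMulMatrix b δ
  have hMtr : M.trace = 0 := by rw [← htr]; exact (Algebra.trace_eq_matrix_trace b δ).symm
  have hM2 : M * M = (-M.det) • (1 : Matrix (Fin 2) (Fin 2) ℤ) := by
    have h11 : M 1 1 = - M 0 0 := by
      rw [Matrix.trace_fin_two] at hMtr; linarith
    ext i j
    rw [Matrix.mul_apply, Fin.sum_univ_two, Matrix.smul_apply, Matrix.det_fin_two, h11]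
    fin_cases i <;> fin_cases j <;> simp [h11] <;> ring
  have hδ : δ ^ 2 = ((-M.det : ℤ) : 𝓞 K) := by
    apply Algebra.leftMulMatrix_injective b
    rw [pow_two, map_mul]
    change M * M = _
    rw [hM2, map_intCast]
    ext i j
    simp [Matrix.one_apply, Matrix.intCast_apply]
  have : -M.det = discr K := by
    rw [hδ] at hsq
    have h2 := Algebra.trace_algebraMap_of_basis b (-M.det)
    simp only [T] at hsq
    rw [eq_intCast, hsq] at h2
    simp at h2
    linarith
  rw [hδ, this]

lemma oc_norm_p (K : Type) [Field K] [NumberField K] (hrank : Module.finrank ℚ K = 2) (p : ℕ) :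
    Ideal.absNorm (Ideal.span {(p : 𝓞 K)}) = p ^ 2 := by
  rw [Ideal.absNorm_span_natCast, RingOfIntegers.rank, hrank]

lemma oc_ram (K : Type) [Field K] [NumberField K] (hrank : Module.finrank ℚ K = 2) (d p : ℕ)
    (δ : 𝓞 K) (hδ : δ ^ 2 = ((-(d:ℤ) : ℤ) : 𝓞 K)) (hp : p.Prime) (hpd : p ∣ d)
    (hpd2 : ¬ p ^ 2 ∣ d) : ∃ P : Ideal (𝓞 K), (p : 𝓞 K) ∈ P ∧ Ideal.absNorm P = p := by
  refine ⟨Ideal.span {(p : 𝓞 K), δ}, Ideal.subset_span (by simp), ?_⟩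
  obtain ⟨m, rfl⟩ := hpd
  have hpm : ¬ p ∣ m := fun h => hpd2 (by rw [pow_two]; exact Nat.mul_dvd_mul_left p h)
  have hc : IsCoprime (p : ℤ) (m : ℤ) := Nat.isCoprime_iff_coprime.2 ((Nat.Prime.coprime_iff_not_dvd hp).2 hpm)
  obtain ⟨u, v, huv⟩ := hc
  have huv' : (u : 𝓞 K) * p + v * m = 1 := by exact_mod_cast congrArg (Int.cast : ℤ → 𝓞 K) huv
  have hδ' : δ * δ = - (p * m) := by rw [← pow_two, hδ]; push_cast; ring
  have hP : Ideal.span {(p : 𝓞 K), δ} * Ideal.span {(p : 𝓞 K), δ} = Ideal.span {(p : 𝓞 K)} := by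
    rw [Ideal.span_pair_mul_span_pair]
    apply le_antisymm
    · rw [Ideal.span_le]
      rintro x (rfl | rfl | rfl | rfl) <;> rw [SetLike.mem_coe, Ideal.mem_span_singleton]
      · exact dvd_mul_right _ _
      · exact dvd_mul_right _ _
      · exact dvd_mul_left _ _
      · rw [hδ']; exact (dvd_mul_right _ _).neg_right
    · rw [Ideal.span_singleton_le_iff_mem]
      have h1 : (p : 𝓞 K) = u * (p * p) + (-v) * (δ * δ) := by
        rw [hδ']; linear_combination (-(p : 𝓞 K)) * huv'
      generalize hI : Ideal.span (_ : Set (𝓞 K)) = I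
      rw [h1]
      subst hI
      exact Ideal.add_mem _ (Ideal.mul_mem_left _ _ (Ideal.subset_span (by simp)))
        (Ideal.mul_mem_left _ _ (Ideal.subset_span (by simp)))
  have := congrArg Ideal.absNorm hP
  rw [map_mul, oc_norm_p K hrank, ← pow_two] at this
  exact Nat.pow_left_injective (n := 2) (by norm_num) this

lemma oc_split_aux (K : Type) [Field K] [NumberField K] (hrank : Module.finrank ℚ K = 2) (d p : ℕ)
    (δ : 𝓞 K) (hδ : δ ^ 2 = ((-(d:ℤ) : ℤ) : 𝓞 K)) (htr : Algebra.trace ℤ (𝓞 K) δ = 0)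
    (hp : p.Prime) (a : ℤ) (ha : (p:ℤ) ∣ a ^ 2 + d) (h2a : ¬ (p : ℤ) ∣ 2 * a) :
    Ideal.span {(p : 𝓞 K), a + δ} * Ideal.span {(p : 𝓞 K), a - δ} = Ideal.span {(p : 𝓞 K)} ∧
    Ideal.span {(p : 𝓞 K), a + δ} ≠ ⊤ := by
  have hc : IsCoprime (p : ℤ) (2 * a) :=
    ((Nat.prime_iff_prime_int.1 hp).coprime_iff_not_dvd).2 h2a
  obtain ⟨u, v, huv⟩ := hc
  have huv' : (u : 𝓞 K) * p + v * (2 * a) = 1 := by exact_mod_cast congrArg (Int.cast : ℤ → 𝓞 K) huv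
  obtain ⟨m, hm⟩ := ha
  have hm' : (a + δ) * (a - δ) = p * m := by
    have : ((a ^ 2 + d : ℤ) : 𝓞 K) = ((p * m : ℤ) : 𝓞 K) := by rw [hm]
    push_cast at this hδ
    linear_combination this - hδ
  have hP : Ideal.span {(p : 𝓞 K), a + δ} * Ideal.span {(p : 𝓞 K), a - δ} = Ideal.span {(p : 𝓞 K)} := by
    rw [Ideal.span_pair_mul_span_pair]
    apply le_antisymm
    · rw [Ideal.span_le]
      rintro x (rfl | rfl | rfl | rfl) <;> rw [SetLike.mem_coe, Ideal.mem_span_singleton]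
      · exact dvd_mul_right _ _
      · exact dvd_mul_right _ _
      · exact dvd_mul_left _ _
      · rw [hm']; exact dvd_mul_right _ _
    · rw [Ideal.span_singleton_le_iff_mem]
      have h1 : (p : 𝓞 K) = u * (p * p) + (v * (p * (a - δ)) + v * ((a + δ) * p)) := by
        linear_combination (-(p : 𝓞 K)) * huv'
      generalize hI : Ideal.span (_ : Set (𝓞 K)) = I
      rw [h1]
      subst hI
      exact Ideal.add_mem _ (Ideal.mul_mem_left _ _ (Ideal.subset_span (by simp)))
        (Ideal.add_mem _ (Ideal.mul_mem_left _ _ (Ideal.subset_span (by simp)))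
        (Ideal.mul_mem_left _ _ (Ideal.subset_span (by simp))))
  refine ⟨hP, fun htop => ?_⟩
  rw [htop, Ideal.top_mul] at hP
  have hmem : (a - δ : 𝓞 K) ∈ Ideal.span {(p : 𝓞 K)} := hP ▸ Ideal.subset_span (by simp)
  obtain ⟨x, hx⟩ := Ideal.mem_span_singleton.1 hmem
  have hfr : Module.finrank ℤ (𝓞 K) = 2 := by rw [RingOfIntegers.rank, hrank]
  have h1 := congrArg (Algebra.trace ℤ (𝓞 K)) hx
  have h2 := Algebra.trace_algebraMap (R := ℤ) (S := 𝓞 K) a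
  rw [eq_intCast, hfr] at h2
  have h3 : (p : 𝓞 K) * x = (p : ℤ) • x := by simp
  rw [map_sub, htr, h2, h3, map_smul] at h1
  apply h2a
  exact ⟨_, by simpa using h1⟩

lemma oc_split (K : Type) [Field K] [NumberField K] (hrank : Module.finrank ℚ K = 2) (d p : ℕ)
    (δ : 𝓞 K) (hδ : δ ^ 2 = ((-(d:ℤ) : ℤ) : 𝓞 K)) (htr : Algebra.trace ℤ (𝓞 K) δ = 0)
    (hp : p.Prime) (a : ℤ) (ha : (p:ℤ) ∣ a ^ 2 + d) (h2a : ¬ (p : ℤ) ∣ 2 * a) :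
    ∃ P Q : Ideal (𝓞 K), P ≠ Q ∧ ((p : 𝓞 K) ∈ P ∧ Ideal.absNorm P = p) ∧
      ((p : 𝓞 K) ∈ Q ∧ Ideal.absNorm Q = p) := by
  obtain ⟨h1, h2⟩ := oc_split_aux K hrank d p δ hδ htr hp a ha h2a
  obtain ⟨-, h3⟩ := oc_split_aux K hrank d p (-δ) (by rw [neg_sq, hδ]) (by rw [map_neg, htr, neg_zero]) hp a ha h2a
  rw [← sub_eq_add_neg] at h3
  have hN := congrArg Ideal.absNorm h1
  rw [map_mul, oc_norm_p K hrank, Nat.Prime.mul_eq_prime_sq_iff hp (by rwa [ne_eq, Ideal.absNorm_eq_one_iff])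
    (by rwa [ne_eq, Ideal.absNorm_eq_one_iff])] at hN
  refine ⟨_, _, fun he => h2 ?_, ⟨Ideal.subset_span (by simp), hN.1⟩, ⟨Ideal.subset_span (by simp), hN.2⟩⟩
  rw [Ideal.eq_top_iff_one]
  have hc : IsCoprime (p : ℤ) (2 * a) :=
    ((Nat.prime_iff_prime_int.1 hp).coprime_iff_not_dvd).2 h2a
  obtain ⟨u, v, huv⟩ := hc
  have huv' : (u : 𝓞 K) * p + v * (2 * a) = 1 := by exact_mod_cast congrArg (Int.cast : ℤ → 𝓞 K) huv
  have m1 : (p : 𝓞 K) ∈ Ideal.span {(p : 𝓞 K), a + δ} := Ideal.subset_span (by simp)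
  have m2 : (a + δ : 𝓞 K) ∈ Ideal.span {(p : 𝓞 K), a + δ} := Ideal.subset_span (by simp)
  have m3 : (a - δ : 𝓞 K) ∈ Ideal.span {(p : 𝓞 K), a + δ} := he ▸ Ideal.subset_span (by simp)
  have : (1 : 𝓞 K) = u * p + v * ((a + δ) + (a - δ)) := by rw [← huv']; ring
  rw [this]
  exact Ideal.add_mem _ (Ideal.mul_mem_left _ _ m1) (Ideal.mul_mem_left _ _ (Ideal.add_mem _ m2 m3))

lemma oc_gen (K : Type) [Field K] [NumberField K] (hrank : Module.finrank ℚ K = 2) (p : ℕ)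
    (hp : p.Prime) : ∃ P : Ideal (𝓞 K), Prime P ∧ (p : 𝓞 K) ∈ P ∧ 1 < Ideal.absNorm P ∧ Ideal.absNorm P ≤ p ^ 2 := by
  have hne : Ideal.span {(p : 𝓞 K)} ≠ ⊤ := by
    rw [ne_eq, ← Ideal.absNorm_eq_one_iff, oc_norm_p K hrank]
    have := hp.one_lt
    intro h
    simp at h
    omega
  obtain ⟨P, hP, hle⟩ := Ideal.exists_le_maximal _ hne
  have hmem : (p : 𝓞 K) ∈ P := hle (Ideal.mem_span_singleton_self _)
  have hdvd := Ideal.absNorm_dvd_absNorm_of_le hle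
  rw [oc_norm_p K hrank] at hdvd
  have hpos : 0 < p ^ 2 := pow_pos hp.pos 2
  have hbot : P ≠ ⊥ := by
    rintro rfl
    simp at hdvd
    exact hp.ne_zero hdvd
  have h0 : Ideal.absNorm P ≠ 0 := by rwa [ne_eq, Ideal.absNorm_eq_zero_iff]
  have h1 : Ideal.absNorm P ≠ 1 := by rw [ne_eq, Ideal.absNorm_eq_one_iff]; exact hP.ne_top
  exact ⟨P, Ideal.prime_of_isPrime hbot hP.isPrime, hmem, by omega, Nat.le_of_dvd hpos hdvd⟩

lemma oc_prime_of_norm (K : Type) [Field K] [NumberField K] (p : ℕ) (hp : p.Prime) (P : Ideal (𝓞 K))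
    (h : Ideal.absNorm P = p) : Prime P := by
  refine Ideal.prime_of_isPrime ?_ (Ideal.isPrime_of_irreducible_absNorm (by rw [h]; exact hp))
  rintro rfl
  simp at h
  exact hp.ne_zero h.symm

lemma oc_sq_not_dvd (d p : ℕ) (hfund : IsFundamentalDiscriminant (-(d : ℤ))) (hp : p.Prime)
    (hp2 : p ≠ 2) : ¬ p ^ 2 ∣ d := by
  intro h
  have h1 : (p : ℤ) * p ∣ -(d : ℤ) := by
    rw [dvd_neg, ← pow_two]; exact_mod_cast h
  have hnu : ¬ IsUnit (p : ℤ) := (Nat.prime_iff_prime_int.1 hp).not_isUnit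
  rcases hfund with ⟨-, hs⟩ | ⟨h4, hs, -⟩
  · exact hnu (hs _ h1)
  · obtain ⟨m, hm⟩ := Int.dvd_of_emod_eq_zero h4
    rw [hm, Int.mul_ediv_cancel_left _ (by norm_num)] at hs
    rw [hm] at h1
    have hc : IsCoprime ((p : ℤ) * p) 4 := by
      have h5 : Nat.Coprime (p * p) 4 := by
        have h6 : Nat.Coprime p 2 := (Nat.coprime_primes hp Nat.prime_two).2 hp2
        have h7 : Nat.Coprime p (2 * 2) := h6.mul_right h6
        exact h7.mul_left h7
      have := Nat.isCoprime_iff_coprime.2 h5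
      exact_mod_cast this
    exact hnu (hs _ (hc.dvd_of_dvd_mul_left h1))

lemma oc_local (K : Type) [Field K] [NumberField K] (hrank : Module.finrank ℚ K = 2) (d : ℕ) [NeZero d]
    (hfund : IsFundamentalDiscriminant (-(d : ℤ)))
    (χ : DirichletCharacter ℂ d) (hχ : IsQuadFieldChar d χ)
    (δ : 𝓞 K) (hδ : δ ^ 2 = ((-(d:ℤ) : ℤ) : 𝓞 K)) (htr : Algebra.trace ℤ (𝓞 K) δ = 0)
    (p : ℕ) (hp : p.Prime) :
    ∃ T : Finset (Ideal (𝓞 K)), (∀ P ∈ T, Prime P ∧ (p : 𝓞 K) ∈ P ∧ 1 < Ideal.absNorm P) ∧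
      ∀ s : ℝ, 1 < s → ‖(1 - (p : ℂ) ^ (-(s : ℂ)))⁻¹‖ * ‖(1 - χ p * (p : ℂ) ^ (-(s : ℂ)))⁻¹‖ ≤
        (if p = 2 then 3 else 1) * ∏ P ∈ T, (1 - (Ideal.absNorm P : ℝ) ^ (-s))⁻¹ := by
  have hp1 : (1:ℝ) < p := by exact_mod_cast hp.one_lt
  have hx : ∀ s : ℝ, (p : ℂ) ^ (-(s : ℂ)) = (((p : ℝ) ^ (-s) : ℝ) : ℂ) := by
    intro s
    rw [Complex.ofReal_cpow (by positivity)]; push_cast; rfl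
  have hx0 : ∀ s : ℝ, 0 < (p : ℝ) ^ (-s) := fun s => by positivity
  have hx1 : ∀ s : ℝ, 1 < s → (p : ℝ) ^ (-s) ≤ 1 / 2 := by
    intro s hs
    calc (p : ℝ) ^ (-s) ≤ (p : ℝ) ^ (-1 : ℝ) := Real.rpow_le_rpow_of_exponent_le hp1.le (by linarith)
      _ = (p : ℝ)⁻¹ := Real.rpow_neg_one _
      _ ≤ 1 / 2 := by
        rw [one_div]
        apply inv_anti₀ (by norm_num)
        exact_mod_cast hp.two_le
  have hz : ∀ s : ℝ, 1 < s → ‖(1 - (p : ℂ) ^ (-(s : ℂ)))⁻¹‖ = (1 - (p : ℝ) ^ (-s))⁻¹ := by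
    intro s hs
    rw [hx, norm_inv, ← Complex.ofReal_one, ← Complex.ofReal_sub, Complex.norm_real, Real.norm_eq_abs,
      abs_of_pos (by linarith [hx1 s hs])]
  obtain ⟨P₀, hP₀, hm₀, hn₀, hn₀'⟩ := oc_gen K hrank p hp
  have hgen : ∀ s : ℝ, 1 < s → (1 - ((p : ℝ) ^ (-s)) ^ 2)⁻¹ ≤ (1 - (Ideal.absNorm P₀ : ℝ) ^ (-s))⁻¹ := by
    intro s hs
    have hn1 : (1:ℝ) < Ideal.absNorm P₀ := by exact_mod_cast hn₀
    have h1 : (Ideal.absNorm P₀ : ℝ) ^ (-s) < 1 := Real.rpow_lt_one_of_one_lt_of_neg hn1 (by linarith)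
    have h2 : ((p : ℝ) ^ (-s)) ^ 2 ≤ (Ideal.absNorm P₀ : ℝ) ^ (-s) := by
      rw [← Real.rpow_natCast, ← Real.rpow_mul (by positivity), mul_comm, Real.rpow_mul (by positivity),
        Real.rpow_natCast]
      apply Real.rpow_le_rpow_of_nonpos (by positivity) _ (by linarith)
      exact_mod_cast hn₀'
    apply inv_anti₀ <;> linarith
  by_cases hp2 : p = 2
  · refine ⟨{P₀}, by simpa using ⟨hP₀, hm₀, hn₀⟩, fun s hs => ?_⟩
    rw [hz s hs, if_pos hp2, prod_singleton]
    refine le_trans ?_ (mul_le_mul_of_nonneg_left (hgen s hs) (by norm_num))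
    have h0 := hx0 s
    have h1 := hx1 s hs
    have hL : ‖(1 - χ p * (p : ℂ) ^ (-(s : ℂ)))⁻¹‖ ≤ (1 - (p : ℝ) ^ (-s))⁻¹ := by
      rw [norm_inv]
      apply inv_anti₀ (by linarith)
      have h2 := norm_sub_norm_le (1 : ℂ) (χ p * (p : ℂ) ^ (-(s : ℂ)))
      have h3 : ‖χ p * (p : ℂ) ^ (-(s : ℂ))‖ ≤ (p : ℝ) ^ (-s) := by
        rw [norm_mul, hx, Complex.norm_real, Real.norm_eq_abs, abs_of_pos h0]
        have := χ.norm_le_one p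
        nlinarith
      rw [norm_one] at h2
      linarith
    generalize (p : ℝ) ^ (-s) = x at *
    calc (1 - x)⁻¹ * ‖(1 - χ p * (p : ℂ) ^ (-(s : ℂ)))⁻¹‖ ≤ (1 - x)⁻¹ * (1 - x)⁻¹ :=
          mul_le_mul_of_nonneg_left hL (inv_nonneg.2 (by linarith))
      _ ≤ 3 * (1 - x ^ 2)⁻¹ := by
        have e1 : 0 < 1 - x := by linarith
        have e2 : 0 < 1 - x ^ 2 := by nlinarith
        rw [← mul_inv, ← one_div, ← div_eq_mul_inv, div_le_div_iff₀ (by positivity) e2]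
        nlinarith
  by_cases hpd : p ∣ d
  · obtain ⟨P, hm, hN⟩ := oc_ram K hrank d p δ hδ hp hpd (oc_sq_not_dvd d p hfund hp hp2)
    refine ⟨{P}, by simpa using ⟨oc_prime_of_norm K p hp P hN, hm, hN ▸ hp.one_lt⟩, fun s hs => ?_⟩
    have hc : χ (p : ZMod d) = 0 := by
      apply χ.map_nonunit
      rw [ZMod.isUnit_iff_coprime]
      intro h
      exact hp.one_lt.ne' ((Nat.gcd_eq_left hpd).symm.trans h)
    rw [hz s hs, hc, prod_singleton, hN, if_neg hp2]
    simp
  · have hv := hχ p hp hp2 hpd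
    haveI : Fact p.Prime := ⟨hp⟩
    have hne : ((-(d:ℤ) : ℤ) : ZMod p) ≠ 0 := by
      rw [ne_eq, ZMod.intCast_zmod_eq_zero_iff_dvd, dvd_neg]
      exact_mod_cast hpd
    rcases legendreSym.eq_one_or_neg_one p hne with h | h
    · rw [h] at hv
      obtain ⟨a, ha⟩ := (legendreSym.eq_one_iff p hne).1 h
      have haa : ((a.val : ℤ) : ZMod p) = a := by simp
      have h1 : (p : ℤ) ∣ (a.val : ℤ) ^ 2 + d := by
        rw [← ZMod.intCast_zmod_eq_zero_iff_dvd, Int.cast_add, Int.cast_pow, haa, pow_two, ← ha]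
        push_cast; ring
      have hpi := Nat.prime_iff_prime_int.1 hp
      have h2 : ¬ (p : ℤ) ∣ 2 * (a.val : ℤ) := by
        intro hd2
        rcases hpi.dvd_or_dvd hd2 with h3 | h3
        · have h4 : p ∣ 2 := by exact_mod_cast h3
          exact hp2 ((Nat.prime_dvd_prime_iff_eq hp Nat.prime_two).1 h4)
        · have h5 : (p : ℤ) ∣ (d : ℤ) := by
            have := dvd_sub h1 (dvd_pow h3 (two_ne_zero))
            simpa using this
          exact hpd (by exact_mod_cast h5)
      obtain ⟨P, Q, hPQ, ⟨hmP, hNP⟩, hmQ, hNQ⟩ := oc_split K hrank d p δ hδ htr hp _ h1 h2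
      classical
      refine ⟨{P, Q}, ?_, fun s hs => ?_⟩
      · intro I hI
        rw [mem_insert, mem_singleton] at hI
        rcases hI with rfl | rfl
        · exact ⟨oc_prime_of_norm K p hp _ hNP, hmP, hNP ▸ hp.one_lt⟩
        · exact ⟨oc_prime_of_norm K p hp _ hNQ, hmQ, hNQ ▸ hp.one_lt⟩
      · rw [hv, prod_pair hPQ, hNP, hNQ, if_neg hp2, Int.cast_one, one_mul, one_mul, hz s hs]
    · rw [h] at hv
      refine ⟨{P₀}, by simpa using ⟨hP₀, hm₀, hn₀⟩, fun s hs => ?_⟩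
      rw [hz s hs, if_neg hp2, prod_singleton, one_mul]
      refine le_trans (le_of_eq ?_) (hgen s hs)
      have h0 := hx0 s
      rw [hv, hx, norm_inv]
      have : (1 - ((-1 : ℤ) : ℂ) * (((p : ℝ) ^ (-s) : ℝ) : ℂ)) = ((1 + (p : ℝ) ^ (-s) : ℝ) : ℂ) := by
        push_cast; ring
      rw [this, Complex.norm_real, Real.norm_eq_abs, abs_of_pos (by linarith), ← mul_inv]
      congr 1; ring

lemma oc_global (K : Type) [Field K] [NumberField K] (hrank : Module.finrank ℚ K = 2) (d : ℕ) [NeZero d]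
    (hfund : IsFundamentalDiscriminant (-(d : ℤ))) (hdisc : NumberField.discr K = -(d : ℤ))
    (χ : DirichletCharacter ℂ d) (hχ : IsQuadFieldChar d χ) (s : ℝ) (hs : 1 < s)
    (hne : dedekindZeta K s ≠ 0) :
    ‖riemannZeta s‖ * ‖DirichletCharacter.LFunction χ s‖ ≤ 3 * ‖dedekindZeta K s‖ := by
  classical
  obtain ⟨δ, hδ, htr⟩ := oc_delta K hrank
  rw [hdisc] at hδ
  choose T hT hTs using fun p : Nat.Primes => oc_local K hrank d hfund χ hχ δ hδ htr p.1 p.2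
  obtain ⟨hsum, hz⟩ := oc_zeta_hasSum K s hs hne
  set F : Ideal (𝓞 K) → ℝ := fun I => (Ideal.absNorm I : ℝ) ^ (-s) with hF
  have hFnn : ∀ I, 0 ≤ F I := fun I => by positivity
  have hnorm : ‖dedekindZeta K s‖ = ∑' I, F I := by
    rw [hz, Complex.norm_real, Real.norm_eq_abs, abs_of_nonneg (tsum_nonneg hFnn)]
  have hs' : 1 < (s : ℂ).re := by simpa using hs
  have h1 := (riemannZeta_eulerProduct_hasProd hs').norm
  have h2 := (DirichletCharacter.LSeries_eulerProduct_hasProd χ hs').norm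
  rw [← DirichletCharacter.LFunction_eq_LSeries χ hs'] at h2
  have h3 := h1.mul h2
  rw [hnorm]
  refine le_of_tendsto h3 (Filter.Eventually.of_forall fun S => ?_)
  have hlt : ∀ p : Nat.Primes, ∀ P ∈ T p, F P < 1 := by
    intro p P hP
    have : (1:ℝ) < Ideal.absNorm P := by exact_mod_cast (hT p P hP).2.2
    exact Real.rpow_lt_one_of_one_lt_of_neg this (by linarith)
  calc _ ≤ ∏ p ∈ S, ((if p.1 = 2 then (3:ℝ) else 1) * ∏ P ∈ T p, (1 - F P)⁻¹) := by
        apply Finset.prod_le_prod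
        · intro p _; positivity
        · intro p _; exact hTs p s hs
    _ = (∏ p ∈ S, (if p.1 = 2 then (3:ℝ) else 1)) * ∏ P ∈ S.biUnion T, (1 - F P)⁻¹ := by
        rw [prod_mul_distrib, prod_biUnion]
        intro p _ q _ hpq
        rw [Function.onFun, Finset.disjoint_left]
        intro P hP hQ
        have hpq' : Nat.Coprime p.1 q.1 := (Nat.coprime_primes p.2 q.2).2 (fun h => hpq (Subtype.ext h))
        obtain ⟨u, v, huv⟩ := Nat.isCoprime_iff_coprime.2 hpq'
        have huv' : (u : 𝓞 K) * (p.1 : 𝓞 K) + v * (q.1 : 𝓞 K) = 1 := by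
          exact_mod_cast congrArg (Int.cast : ℤ → 𝓞 K) huv
        have hone : (1 : 𝓞 K) ∈ P := by
          rw [← huv']
          exact P.add_mem (P.mul_mem_left _ (hT p P hP).2.1) (P.mul_mem_left _ (hT q P hQ).2.1)
        have := (Ideal.eq_top_iff_one P).2 hone
        have h5 := (hT p P hP).2.2
        rw [this, Ideal.absNorm_top] at h5
        exact lt_irrefl _ h5
    _ ≤ 3 * ∑' I, F I := by
        apply mul_le_mul
        · obtain ⟨q, hq⟩ : ∃ q : Nat.Primes, q.1 = 2 := ⟨⟨2, Nat.prime_two⟩, rfl⟩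
          have : ∀ p ∈ S, (if p.1 = 2 then (3:ℝ) else 1) = if p = q then 3 else 1 := by
            intro p _
            by_cases h : p = q
            · rw [if_pos h, if_pos (by rw [h, hq])]
            · rw [if_neg h, if_neg (fun h' => h (Subtype.ext (h'.trans hq.symm)))]
          rw [Finset.prod_congr rfl this, Finset.prod_ite_eq']
          split_ifs <;> norm_num
        · apply oc_euler_le F _ hFnn hsum _ _ _ _
          · intro I J
            simp only [hF]
            rw [map_mul, Nat.cast_mul, Real.mul_rpow (by positivity) (by positivity)]
          · simp [hF]
          · intro P hP
            obtain ⟨p, -, hp⟩ := mem_biUnion.1 hP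
            exact (hT p P hp).1
          · intro P hP
            obtain ⟨p, -, hp⟩ := mem_biUnion.1 hP
            exact hlt p P hp
        · apply prod_nonneg
          intro P hP
          obtain ⟨p, -, hp⟩ := mem_biUnion.1 hP
          exact inv_nonneg.2 (by linarith [hlt p P hp])
        · norm_num

lemma oc_residue_ge (K : Type) [Field K] [NumberField K] (hrank : Module.finrank ℚ K = 2) (d : ℕ) [NeZero d]
    (hfund : IsFundamentalDiscriminant (-(d : ℤ))) (hdisc : NumberField.discr K = -(d : ℤ))
    (χ : DirichletCharacter ℂ d) (hχ : IsQuadFieldChar d χ) :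
    ‖DirichletCharacter.LFunction χ 1‖ ≤ 3 * dedekindZeta_residue K := by
  have hK := tendsto_sub_one_mul_dedekindZeta_nhdsGT K
  have hcast : Tendsto (fun s : ℝ => (s : ℂ)) (𝓝[>] 1) (𝓝[≠] 1) := by
    apply tendsto_nhdsWithin_of_tendsto_nhds_of_eventually_within
    · exact (Complex.continuous_ofReal.tendsto' 1 1 (by simp)).mono_left nhdsWithin_le_nhds
    · filter_upwards [self_mem_nhdsWithin] with s hs
      have : (1:ℝ) < s := hs
      simp only [Set.mem_compl_iff, Set.mem_singleton_iff]
      exact_mod_cast this.ne'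
  have hζ := (riemannZeta_residue_one.comp hcast).norm
  have hev : ∀ᶠ s : ℝ in 𝓝[>] 1, dedekindZeta K s ≠ 0 := by
    have := hK.eventually_ne (Complex.ofReal_ne_zero.2 (dedekindZeta_residue_ne_zero K))
    filter_upwards [this] with s hs h
    exact hs (by rw [h, mul_zero])
  have hineq : ∀ᶠ s : ℝ in 𝓝[>] 1, ‖((s:ℂ) - 1) * riemannZeta s‖ * ‖DirichletCharacter.LFunction χ s‖ ≤
      3 * ‖((s:ℂ) - 1) * dedekindZeta K s‖ := by
    filter_upwards [hev, self_mem_nhdsWithin] with s h hs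
    have := oc_global K hrank d hfund hdisc χ hχ s hs h
    rw [norm_mul, norm_mul]
    nlinarith [mul_le_mul_of_nonneg_left this (norm_nonneg ((s:ℂ) - 1))]
  have hR := (hK.norm).const_mul 3
  rw [Complex.norm_real, Real.norm_eq_abs, abs_of_pos (dedekindZeta_residue_pos K)] at hR
  by_cases hχ1 : χ = 1
  · exfalso
    have hL := ((DirichletCharacter.LFunctionTrivChar_residue_one (N := d)).comp hcast).norm
    have h0 : Tendsto (fun s : ℝ => ‖(s:ℂ) - 1‖) (𝓝[>] 1) (𝓝 0) := by
      have : Tendsto (fun s : ℝ => ‖(s:ℂ) - 1‖) (𝓝 1) (𝓝 0) := by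
        have hc : Continuous (fun s : ℝ => ‖(s:ℂ) - 1‖) := by fun_prop
        exact hc.tendsto' 1 0 (by simp)
      exact this.mono_left nhdsWithin_le_nhds
    have := le_of_tendsto_of_tendsto (hζ.mul hL) (h0.mul hR) (by
      filter_upwards [hineq] with s hs
      simp only [Function.comp_apply]
      rw [hχ1] at hs
      rw [norm_mul (_ : ℂ) (DirichletCharacter.LFunctionTrivChar d s)]
      have := mul_le_mul_of_nonneg_left hs (norm_nonneg ((s:ℂ) - 1))
      calc _ = ‖(s:ℂ) - 1‖ * (‖((s:ℂ) - 1) * riemannZeta s‖ * ‖DirichletCharacter.LFunctionTrivChar d s‖) := by ring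
        _ ≤ _ := this)
    rw [zero_mul, norm_one, one_mul, norm_le_zero_iff, prod_eq_zero_iff] at this
    obtain ⟨p, hp, h⟩ := this
    have hp' := Nat.prime_of_mem_primeFactors hp
    rw [sub_eq_zero, eq_comm, inv_eq_one] at h
    exact hp'.one_lt.ne' (by exact_mod_cast h)
  · have hL : Tendsto (fun s : ℝ => ‖DirichletCharacter.LFunction χ s‖) (𝓝[>] 1)
        (𝓝 ‖DirichletCharacter.LFunction χ 1‖) :=
      (((DirichletCharacter.differentiable_LFunction hχ1).continuous.tendsto 1).comp
        (hcast.mono_right nhdsWithin_le_nhds)).norm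
    have := le_of_tendsto_of_tendsto (hζ.mul hL) hR hineq
    simpa using this

lemma oc_residue_le (K : Type) [Field K] [NumberField K] (hrank : Module.finrank ℚ K = 2) (d : ℕ)
    (hd : 0 < d) (hdisc : NumberField.discr K = -(d : ℤ)) :
    dedekindZeta_residue K ≤ π * classNumber K / √d := by
  have hsign := NumberField.sign_discr K
  have hcard := InfinitePlace.card_add_two_mul_card_eq_rank K
  rw [hrank] at hcard
  have hc : InfinitePlace.nrComplexPlaces K = 1 := by
    have h1 : InfinitePlace.nrComplexPlaces K ≠ 0 := by
      intro h
      rw [h, hdisc, pow_zero, Int.sign_eq_one_iff_pos] at hsign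
      omega
    omega
  have hr : InfinitePlace.nrRealPlaces K = 0 := by omega
  have hcardI : Fintype.card (InfinitePlace K) = 1 := by
    rw [InfinitePlace.card_eq_nrRealPlaces_add_nrComplexPlaces, hc, hr]
  have hrk : Units.rank K = 0 := by rw [Units.rank, hcardI]
  have hreg : Units.regulator K = 1 := by
    classical
    haveI : IsEmpty {w : InfinitePlace K // w ≠ Units.dirichletUnitTheorem.w₀} :=
      ⟨fun w => w.2 (Fintype.card_le_one_iff.1 hcardI.le _ _)⟩
    rw [Units.regulator_eq_det' K, Matrix.det_isEmpty, abs_one]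
  have hw : (2:ℝ) ≤ Units.torsionOrder K := by
    obtain ⟨k, hk⟩ := Units.even_torsionOrder K
    have := Units.torsionOrder_pos K
    have : 2 ≤ Units.torsionOrder K := by omega
    exact_mod_cast this
  have hd' : (0:ℝ) < √d := Real.sqrt_pos.2 (by exact_mod_cast hd)
  rw [dedekindZeta_residue_def, hc, hr, hreg, hdisc]
  have : |((-(d:ℤ) : ℤ) : ℝ)| = d := by push_cast; simp
  rw [this, div_le_div_iff₀ (by positivity) hd']
  have hpos : 0 ≤ π * classNumber K * √d := by positivity
  nlinarith


end

/-- If `-d < -4` is a fundamental discriminant whose class group has one class per genus and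
`L(1, χ_d) ≥ 1/(log d)^74`, then `d ≤ d₂₃₀`, the product of the first 230 primes. -/
theorem one_class_per_genus_bound_74 (d : ℕ) [NeZero d] (hd : 4 < d)
    (hfund : IsFundamentalDiscriminant (-(d : ℤ)))
    (K : Type) [Field K] [NumberField K]
    (hrank : Module.finrank ℚ K = 2) (hdisc : NumberField.discr K = -(d : ℤ))
    (hgenus : NumberField.classNumber K = 2 ^ (d.primeFactors.card - 1))
    (χ : DirichletCharacter ℂ d) (hχ : IsQuadFieldChar d χ)
    (hL : (1 : ℝ) / (Real.log d) ^ 74 ≤ (DirichletCharacter.LFunction χ 1).re) :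
    d ≤ ∏ i ∈ Finset.range 230, Nat.nth Nat.Prime i := by
  by_contra hcon
  have hnum := oc_numeric d (not_le.1 hcon)
  have h1 := oc_residue_ge K hrank d hfund hdisc χ hχ
  have h2 := oc_residue_le K hrank d (by omega) hdisc
  have h3 := (hL.trans (Complex.re_le_norm _)).trans h1
  have h4 : 1 / Real.log d ^ 74 ≤ 3 * (π * NumberField.classNumber K / √d) := h3.trans (by linarith)
  have hlog : 0 < Real.log d := Real.log_pos (by exact_mod_cast (by omega : 1 < d))
  have hd' : (0:ℝ) < √d := Real.sqrt_pos.2 (by exact_mod_cast (by omega : 0 < d))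
  rw [hgenus, ← mul_div_assoc, div_le_div_iff₀ (by positivity) hd'] at h4
  push_cast at h4
  linarith
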